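/- Define the boundary quantum determinant det_qU_−(λ) := ((λ/q)² − (q/λ)²)[A_−(λq^{1/2})A_−(q^{1/2}/λ) + B_−(λq^{1/2})C_−(q^{1/2}/λ)]. Then: (i) det_qU_−(λ) = ((λ/q)² − (q/λ)²)[D_−(λq^{1/2})D_−(q^{1/2}/λ) + C_−(λq^{1/2})B_−(q^{1/2}/λ)]; (ii) det_qU_−(λ) commutes with A_−(μ), B_−(μ), C_−(μ), D_−(μ) for all λ, μ ∈ ℂˣ; (iii) det_qU_−(λ) = (λ²q^{−2} − q²λ^{−2}) 𝖠_−(λq^{1/2}) 𝖠_−(q^{1/2}λ^{−1}) · Id_H. -/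

import Mathlib

open Matrix Polynomial Filter Topology

noncomputable section

namespace SixV

/-- the local space index set `ℤ/(2l+1)ℤ` -/
abbrev Zp (l : ℕ) := ZMod (2 * l + 1)

/-- index set of the quantum space `H = (ℂ^p)^{⊗N}` -/
abbrev HIdx (l N : ℕ) := Fin N → Zp l

/-- operators on the quantum space `H` -/
abbrev Op (l N : ℕ) := Matrix (HIdx l N) (HIdx l N) ℂ

/-- clock matrix `v`, `v|k⟩ = q^k |k⟩` -/
def vM (l : ℕ) (q : ℂ) : Matrix (Zp l) (Zp l) ℂ := Matrix.diagonal fun k => q ^ k.val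

def vMinv (l : ℕ) (q : ℂ) : Matrix (Zp l) (Zp l) ℂ := Matrix.diagonal fun k => (q ^ k.val)⁻¹

/-- shift matrix `u`, `u|k⟩ = |k-1⟩` -/
def uM (l : ℕ) : Matrix (Zp l) (Zp l) ℂ := Matrix.of fun j k => if j = k - 1 then (1 : ℂ) else 0

def uMinv (l : ℕ) : Matrix (Zp l) (Zp l) ℂ := Matrix.of fun j k => if j = k + 1 then (1 : ℂ) else 0

/-- the Bazhanov-Stroganov Lax operator, a `2×2` matrix of `p×p` matrices;
`s` denotes the fixed square root `q^{1/2}` of `q`. -/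
def laxM (l : ℕ) (q s pα pβ pa pb pc pd lam : ℂ) :
    Matrix (Fin 2) (Fin 2) (Matrix (Zp l) (Zp l) ℂ) :=
  Matrix.of
    ![![(lam * pα) • vM l q - (pβ / lam) • vMinv l q,
        uM l * ((pa / s) • vM l q + (s * pb) • vMinv l q)],
      ![uMinv l * ((s * pc) • vM l q + (pd / s) • vMinv l q),
        (pa * pc / pα / lam) • vM l q - (pb * pd / pβ * lam) • vMinv l q]]

/-- the bulk parameters `α_n, β_n, a_n, b_n, c_n, d_n` of the `N`-site chain -/
structure BulkParams (N : ℕ) where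
  α : Fin N → ℂ
  β : Fin N → ℂ
  a : Fin N → ℂ
  b : Fin N → ℂ
  c : Fin N → ℂ
  d : Fin N → ℂ

def BulkParams.NonZero {N : ℕ} (P : BulkParams N) : Prop :=
  ∀ n, P.α n ≠ 0 ∧ P.β n ≠ 0 ∧ P.a n ≠ 0 ∧ P.b n ≠ 0 ∧ P.c n ≠ 0 ∧ P.d n ≠ 0

/-- embedding of a one-site operator at site `n` of the chain -/
def site (l N : ℕ) (n : Fin N) (A : Matrix (Zp l) (Zp l) ℂ) : Op l N :=
  Matrix.of fun x y =>
    A (x n) (y n) * ∏ m ∈ Finset.univ.erase n, (if x m = y m then (1 : ℂ) else 0)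

def laxSite (l N : ℕ) (q s : ℂ) (P : BulkParams N) (n : Fin N) (lam : ℂ) :
    Matrix (Fin 2) (Fin 2) (Op l N) :=
  Matrix.of fun i j =>
    site l N n (laxM l q s (P.α n) (P.β n) (P.a n) (P.b n) (P.c n) (P.d n) lam i j)

/-- bulk monodromy matrix `M(λ) = L_N(λ q^{-1/2}) ⋯ L_1(λ q^{-1/2})` -/
def mono (l N : ℕ) (q s : ℂ) (P : BulkParams N) (lam : ℂ) :
    Matrix (Fin 2) (Fin 2) (Op l N) :=
  (((List.finRange N).reverse).map fun n => laxSite l N q s P n (lam / s)).prod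

/-- boundary parameters `(ζ, κ, τ)` -/
structure Bdry where
  ζ : ℂ
  κ : ℂ
  τ : ℂ

/-- the general scalar solution `K(λ; ζ, κ, τ)` of the reflection equation -/
def kM (q s : ℂ) (B : Bdry) (lam : ℂ) : Matrix (Fin 2) (Fin 2) ℂ :=
  (B.ζ - B.ζ⁻¹)⁻¹ •
    Matrix.of
      ![![lam * B.ζ / s - s / (lam * B.ζ), B.κ * Complex.exp B.τ * (lam ^ 2 / q - q / lam ^ 2)],
        ![B.κ * Complex.exp (-B.τ) * (lam ^ 2 / q - q / lam ^ 2),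
          s * B.ζ / lam - lam / (B.ζ * s)]]

/-- lift of a scalar `2×2` matrix to a `2×2` matrix of operators on `H` -/
def lift2 (l N : ℕ) (K : Matrix (Fin 2) (Fin 2) ℂ) : Matrix (Fin 2) (Fin 2) (Op l N) :=
  Matrix.of fun i j => K i j • (1 : Op l N)

/-- the Pauli matrix `σ^y` acting on the auxiliary space -/
def sigY (l N : ℕ) : Matrix (Fin 2) (Fin 2) (Op l N) :=
  Matrix.of ![![0, (-Complex.I) • (1 : Op l N)], ![Complex.I • (1 : Op l N), 0]]

/-- `M̂(λ) = (-1)^N σ^y M(1/λ)^{t_a} σ^y` (transposition in the auxiliary indices only) -/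
def mHat (l N : ℕ) (q s : ℂ) (P : BulkParams N) (lam : ℂ) :
    Matrix (Fin 2) (Fin 2) (Op l N) :=
  ((-1 : ℂ) ^ N) • (sigY l N * (mono l N q s P lam⁻¹).transpose * sigY l N)

/-- the boundary monodromy matrix `U_-(λ) = M(λ) K_-(λ) M̂(λ)` -/
def uBdry (l N : ℕ) (q s : ℂ) (P : BulkParams N) (Bm : Bdry) (lam : ℂ) :
    Matrix (Fin 2) (Fin 2) (Op l N) :=
  mono l N q s P lam * lift2 l N (kM q s Bm lam) * mHat l N q s P lam

def opA (l N : ℕ) (q s : ℂ) (P : BulkParams N) (Bm : Bdry) (lam : ℂ) : Op l N :=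
  uBdry l N q s P Bm lam 0 0
def opB (l N : ℕ) (q s : ℂ) (P : BulkParams N) (Bm : Bdry) (lam : ℂ) : Op l N :=
  uBdry l N q s P Bm lam 0 1
def opC (l N : ℕ) (q s : ℂ) (P : BulkParams N) (Bm : Bdry) (lam : ℂ) : Op l N :=
  uBdry l N q s P Bm lam 1 0
def opD (l N : ℕ) (q s : ℂ) (P : BulkParams N) (Bm : Bdry) (lam : ℂ) : Op l N :=
  uBdry l N q s P Bm lam 1 1

/-- transfer matrix with the general boundary matrix `K_+(λ) = K(λq; ζ_+, κ_+, τ_+)` -/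
def transferGen (l N : ℕ) (q s : ℂ) (P : BulkParams N) (Bp Bm : Bdry) (lam : ℂ) : Op l N :=
  (lift2 l N (kM q s Bp (lam * q)) * uBdry l N q s P Bm lam).trace

/-- the upper-triangular `K_+` boundary matrix: `K(λq; ζ_+, κ_+, τ_+)` with `(1,2)` entry `0` -/
def kTriPlus (q s : ℂ) (B : Bdry) (lam : ℂ) : Matrix (Fin 2) (Fin 2) ℂ :=
  Matrix.of ![![kM q s B (lam * q) 0 0, 0], ![kM q s B (lam * q) 1 0, kM q s B (lam * q) 1 1]]

/-- transfer matrix with triangular `K_+` -/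
def transferTri (l N : ℕ) (q s : ℂ) (P : BulkParams N) (Bp Bm : Bdry) (lam : ℂ) : Op l N :=
  (lift2 l N (kTriPlus q s Bp lam) * uBdry l N q s P Bm lam).trace

/-- the scalar value `d_q M(λ)` of the bulk quantum determinant -/
def dqM (N : ℕ) (q : ℂ) (P : BulkParams N) (lam : ℂ) : ℂ :=
  (-q) ^ N * ∏ n, (P.β n * P.a n * P.c n / P.α n *
    (lam⁻¹ + q⁻¹ * P.b n * P.α n * lam / (P.a n * P.β n)) *
    (lam⁻¹ + q⁻¹ * P.d n * P.α n * lam / (P.c n * P.β n)))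

/-- the bulk function `a(λ)` -/
def aBulk (N : ℕ) (q a0 : ℂ) (P : BulkParams N) (lam : ℂ) : ℂ :=
  a0 * ∏ n, (P.β n / lam + q⁻¹ * P.b n * P.α n * lam / P.a n)

/-- the bulk function `d(λ)` -/
def dBulk (N : ℕ) (q a0 : ℂ) (P : BulkParams N) (lam : ℂ) : ℂ :=
  ((-1 : ℂ) ^ N / a0) *
    ∏ n, (P.a n * P.c n / P.α n * (lam⁻¹ + q * P.d n * P.α n * lam / (P.c n * P.β n)))

/-- the boundary function `g_-(λ)` -/
def gMin (s αm βm lam : ℂ) : ℂ :=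
  (lam * αm / s - s / (lam * αm)) * (lam * βm / s + s / (lam * βm)) /
    ((αm - αm⁻¹) * (βm + βm⁻¹))

/-- the function `𝖠_-(λ) = g_-(λ) a(λ q^{-1/2}) d(q^{-1/2} λ^{-1})` -/
def AAm (N : ℕ) (q s a0 αm βm : ℂ) (P : BulkParams N) (lam : ℂ) : ℂ :=
  gMin s αm βm lam * aBulk N q a0 P (lam / s) * dBulk N q a0 P (s * lam)⁻¹

/-- `a_0 = (-q)^N ∏_n q^{-j_n}` -/
def a0def (N : ℕ) (q : ℂ) (j : Fin N → ℕ) : ℂ := (-q) ^ N * ∏ n, (q ^ (j n))⁻¹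

/-- the coefficient `𝖺_+(λ)` -/
def aPl (q s ζp lam : ℂ) : ℂ :=
  (lam ^ 2 * q - 1 / (q * lam ^ 2)) * (lam * ζp / s - s / (lam * ζp)) /
    ((lam ^ 2 - 1 / lam ^ 2) * (ζp - ζp⁻¹))

/-- the coefficient `𝖽_+(λ)` -/
def dPl (q s ζp lam : ℂ) : ℂ :=
  (lam ^ 2 * q - 1 / (q * lam ^ 2)) * (ζp * s / lam - lam / (s * ζp)) /
    ((lam ^ 2 - 1 / lam ^ 2) * (ζp - ζp⁻¹))

/-- the function `k(λ)` -/
def kFun (q lam : ℂ) : ℂ := (lam ^ 2 - 1 / lam ^ 2) / (lam ^ 2 / q ^ 2 - q ^ 2 / lam ^ 2)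

/-- the separation points `ξ_n^{(h)} = μ_{n,+} q^{h+1/2}` -/
def xiP (N : ℕ) (q s : ℂ) (muP : Fin N → ℂ) (n : Fin N) (h : ℕ) : ℂ := muP n * q ^ h * s

/-- `X_n^{(h)} = (ξ_n^{(h)})^2 + (ξ_n^{(h)})^{-2}` -/
def XVal (N : ℕ) (q s : ℂ) (muP : Fin N → ℂ) (n : Fin N) (h : ℕ) : ℂ :=
  (xiP N q s muP n h) ^ 2 + ((xiP N q s muP n h) ^ 2)⁻¹

/-- the `B_-`-eigenvalue function `b_h(λ)` -/
def bEig (N : ℕ) (q s : ℂ) (Bm : Bdry) (P : BulkParams N) (muP : Fin N → ℂ)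
    (h : Fin N → ℕ) (lam : ℂ) : ℂ :=
  Bm.κ * Complex.exp Bm.τ * ((lam ^ 2 / q - q / lam ^ 2) / (Bm.ζ - Bm.ζ⁻¹)) *
    ∏ n, (P.α n * P.β n *
      (lam / xiP N q s muP n (h n) - xiP N q s muP n (h n) / lam) *
      ((lam * xiP N q s muP n (h n))⁻¹ - lam * xiP N q s muP n (h n)))

/-- the reference covector `⟨Ω| = ⊗_n ⟨j_n - 1|` -/
def refL (l N : ℕ) (j : Fin N → ℕ) : HIdx l N → ℂ :=
  fun x => ∏ n, (if x n = (j n : Zp l) - 1 then (1 : ℂ) else 0)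

/-- the reference vector `|Ω̄⟩ = ⊗_n |j_n⟩` -/
def refR (l N : ℕ) (j : Fin N → ℕ) : HIdx l N → ℂ :=
  fun x => ∏ n, (if x n = (j n : Zp l) then (1 : ℂ) else 0)

/-- the operator `∏_n ∏_{k=1}^{h_n} A_-(1/ξ_n^{(k-1)}) / 𝖠_-(1/ξ_n^{(k-1)})` -/
def leftOp (l N : ℕ) (q s a0 αm βm : ℂ) (P : BulkParams N) (Bm : Bdry) (muP : Fin N → ℂ)
    (h : Fin N → ℕ) : Op l N :=
  ((List.finRange N).map fun n =>
    (((List.range (h n)).map fun k =>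
      (AAm N q s a0 αm βm P ((xiP N q s muP n k)⁻¹))⁻¹ •
        opA l N q s P Bm ((xiP N q s muP n k)⁻¹)).prod)).prod

/-- the left SoV covector `⟨h|` -/
def leftSoV (l N : ℕ) (q s a0 αm βm : ℂ) (P : BulkParams N) (Bm : Bdry) (muP : Fin N → ℂ)
    (j h : Fin N → ℕ) : HIdx l N → ℂ :=
  Matrix.vecMul (refL l N j) (leftOp l N q s a0 αm βm P Bm muP h)

/-- the operator `∏_n ∏_{k=h_n}^{p-2} D_-(ξ_n^{(k+1)})/(k(ξ_n^{(k+1)}) 𝖠_-(1/ξ_n^{(k)}))` -/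
def rightOp (l N : ℕ) (q s a0 αm βm : ℂ) (P : BulkParams N) (Bm : Bdry) (muP : Fin N → ℂ)
    (h : Fin N → ℕ) : Op l N :=
  ((List.finRange N).map fun n =>
    (((List.range' (h n) (2 * l - h n)).map fun k =>
      (kFun q (xiP N q s muP n (k + 1)) * AAm N q s a0 αm βm P ((xiP N q s muP n k)⁻¹))⁻¹ •
        opD l N q s P Bm (xiP N q s muP n (k + 1))).prod)).prod

/-- the right SoV vector `|h⟩` -/
def rightSoV (l N : ℕ) (q s a0 αm βm : ℂ) (P : BulkParams N) (Bm : Bdry) (muP : Fin N → ℂ)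
    (j h : Fin N → ℕ) : HIdx l N → ℂ :=
  Matrix.mulVec (rightOp l N q s a0 αm βm P Bm muP h) (refR l N j)

/-- the condition (E-SOV) -/
def ESOV (N p : ℕ) (muP : Fin N → ℂ) : Prop :=
  ∀ n m : Fin N, n ≠ m → (muP n) ^ p ≠ (muP m) ^ p

/-- the condition (SoV-2) -/
def SOV2 (N l : ℕ) (q αm βm : ℂ) (muP muM : Fin N → ℂ) : Prop :=
  (∀ n, (muP n) ^ (2 * (2 * l + 1)) ≠ 1 ∧ (muP n) ^ (2 * (2 * l + 1)) ≠ -1) ∧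
  (∀ ε : ℤ, ε = 1 ∨ ε = -1 → ∀ h : ℕ, 1 ≤ h → h ≤ 2 * l → ∀ n m : Fin N,
    (muP n) ^ 2 ≠ q ^ (-2 * (h : ℤ)) * αm ^ (2 * ε) ∧
    (muP n) ^ 2 ≠ -(q ^ (-2 * (h : ℤ)) * βm ^ (2 * ε)) ∧
    (muP n) ^ 2 ≠ q ^ (-2 * ε - 2 * (h : ℤ)) * (muM m) ^ (2 * ε))

/-- the condition (cond-simple) -/
def CondSimple (N l : ℕ) (q ζp : ℂ) (muP : Fin N → ℂ) : Prop :=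
  ∀ h : ℕ, 1 ≤ h → h ≤ 2 * l → ∀ n : Fin N,
    (muP n) ^ 2 ≠ q ^ (-2 * (h : ℤ)) * ζp ^ 2 ∧
    (muP n) ^ 2 ≠ q ^ (-2 * (h : ℤ)) * ζp ^ (-2 : ℤ)

/-- the Vandermonde product `∏_{1 ≤ b < a ≤ N} (x_a - x_b)` -/
def vdm (N : ℕ) (x : Fin N → ℂ) : ℂ := ∏ a : Fin N, ∏ b ∈ Finset.Iio a, (x a - x b)

/-- the `p×p` Baxter matrix `D_{τ,f}(λ)` -/
def dMat (l : ℕ) (q : ℂ) (tf ff : ℂ → ℂ) (lam : ℂ) : Matrix (Zp l) (Zp l) ℂ :=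
  Matrix.of fun j k =>
    if k = j then tf (q ^ j.val * lam)
    else if k = j + 1 then -ff ((q ^ j.val * lam)⁻¹)
    else if k = j - 1 then -ff (q ^ j.val * lam)
    else 0

/-- the coefficient `𝖺(λ) = 𝖺_+(λ) 𝖠_-(λ)` -/
def sfA (N : ℕ) (q s a0 αm βm ζp : ℂ) (P : BulkParams N) (lam : ℂ) : ℂ :=
  aPl q s ζp lam * AAm N q s a0 αm βm P lam

/-- the coefficient `ā(λ) = λ q^{-1/2} 𝖺(λ)` -/
def sfAbar (N : ℕ) (q s a0 αm βm ζp : ℂ) (P : BulkParams N) (lam : ℂ) : ℂ :=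
  lam / s * sfA N q s a0 αm βm ζp P lam

/-- the coefficient `𝖽(λ) = 𝖽_+(λ) 𝖣_-(λ)`, `𝖣_-(λ) = k(λ) 𝖠_-(q/λ)` -/
def sfD (N : ℕ) (q s a0 αm βm ζp : ℂ) (P : BulkParams N) (lam : ℂ) : ℂ :=
  dPl q s ζp lam * (kFun q lam * AAm N q s a0 αm βm P (q / lam))

/-- the asymptotic value `τ_∞` for the general transfer matrix -/
def tauInfGen (N : ℕ) (q : ℂ) (Bp Bm : Bdry) (P : BulkParams N) : ℂ :=
  Bp.κ * Bm.κ *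
    (Complex.exp (Bp.τ - Bm.τ) * (∏ n, (P.b n * P.d n / P.β n * (P.a n * P.c n / P.α n))) +
     Complex.exp (Bm.τ - Bp.τ) * (∏ n, (P.α n * P.β n))) /
    ((Bp.ζ - Bp.ζ⁻¹) * (Bm.ζ - Bm.ζ⁻¹))

/-- the asymptotic value `τ_∞` for the triangular `K_+` transfer matrix -/
def tauInfTri (N : ℕ) (Bp Bm : Bdry) (P : BulkParams N) : ℂ :=
  (-1 : ℂ) ^ N * Bp.κ * Bm.κ * Complex.exp (Bm.τ - Bp.τ) * (∏ n, (P.α n * P.β n)) /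
    ((Bp.ζ - Bp.ζ⁻¹) * (Bm.ζ - Bm.ζ⁻¹))

/-- the function `F(λ)` -/
def Ff (l N : ℕ) (q s : ℂ) (muP : Fin N → ℂ) (lam : ℂ) : ℂ :=
  ∏ n : Fin N,
    ((lam ^ (2 * l + 1) / (xiP N q s muP n 0) ^ (2 * l + 1) -
        (xiP N q s muP n 0) ^ (2 * l + 1) / lam ^ (2 * l + 1)) *
     (lam ^ (2 * l + 1) * (xiP N q s muP n 0) ^ (2 * l + 1) -
        (lam ^ (2 * l + 1) * (xiP N q s muP n 0) ^ (2 * l + 1))⁻¹))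

/-- the asymptotic value `ā_∞` -/
def abarInf (N : ℕ) (q αm βm : ℂ) (Bp Bm : Bdry) (P : BulkParams N) : ℂ :=
  (-1 : ℂ) ^ N * αm * βm * Bp.ζ * Bm.κ * (∏ n, (P.b n * P.c n)) /
    (q ^ (1 + N) * (Bp.ζ - Bp.ζ⁻¹) * (Bm.ζ - Bm.ζ⁻¹))

/-- the inhomogeneity `G(λ | x, y)` -/
def Gf (l N : ℕ) (q s a0 αm βm : ℂ) (Bp Bm : Bdry) (P : BulkParams N) (muP : Fin N → ℂ)
    (lam x y : ℂ) : ℂ :=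
  Ff l N q s muP lam *
    ((tauInfTri N Bp Bm P - q ^ (-(4 * (l : ℤ) * N)) * abarInf N q αm βm Bp Bm P) * x *
        ((lam / s - s / lam) * (s * lam - (s * lam)⁻¹) *
         (lam / (Complex.I * s) - Complex.I * s / lam) *
         (Complex.I * s * lam - (Complex.I * s * lam)⁻¹)) +
      (Complex.I - 1) * y * sfA N q s a0 αm βm Bp.ζ P (Complex.I * s) /
          (4 * Ff l N q s muP (Complex.I * s)) *
        ((lam * s - (lam * s)⁻¹) * (lam / s - (lam / s)⁻¹)))

/-- `τ` is an eigenvalue function of the family `T`, i.e. `τ ∈ Σ_T` -/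
def inSpec (l N : ℕ) (T : ℂ → Op l N) (tf : ℂ → ℂ) : Prop :=
  ∃ w : HIdx l N → ℂ, w ≠ 0 ∧ ∀ lam : ℂ, lam ≠ 0 → Matrix.mulVec (T lam) w = tf lam • w

/-- the joint eigenspace `E_τ` of the family `T` -/
def eigSp (l N : ℕ) (T : ℂ → Op l N) (tf : ℂ → ℂ) : Submodule ℂ (HIdx l N → ℂ) :=
  ⨅ lam : {x : ℂ // x ≠ 0},
    Module.End.eigenspace (Matrix.mulVecLin (T lam.1)) (tf lam.1)

/-- the admissible functional form of transfer matrix eigenvalues -/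
def admissible (N : ℕ) (q s tinf : ℂ) (Bp Bm : Bdry) (P : BulkParams N) (tf : ℂ → ℂ) : Prop :=
  (∃ Pol : Polynomial ℂ, Pol.degree ≤ ((N + 2 : ℕ) : WithBot ℕ) ∧
      Pol.coeff (N + 2) = tinf ∧
      ∀ lam : ℂ, lam ≠ 0 → tf lam = Pol.eval (lam ^ 2 + (lam ^ 2)⁻¹)) ∧
  tf s = (-1 : ℂ) ^ N * (q + q⁻¹) * dqM N q P 1 ∧
  tf (Complex.I * s) = (-1 : ℂ) ^ N * (q + q⁻¹) *
    ((Bp.ζ + Bp.ζ⁻¹) * (Bm.ζ + Bm.ζ⁻¹) / ((Bp.ζ - Bp.ζ⁻¹) * (Bm.ζ - Bm.ζ⁻¹))) *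
    dqM N q P Complex.I

/-- the separate state with coefficients `Q_a^{(h_a)}` in the right SoV basis -/
def sovVec (l N : ℕ) (q s a0 αm βm : ℂ) (P : BulkParams N) (Bm : Bdry) (muP : Fin N → ℂ)
    (j : Fin N → ℕ) (Q : Fin N → Zp l → ℂ) : HIdx l N → ℂ :=
  ∑ h : Fin N → Fin (2 * l + 1),
    ((∏ a, Q a ((h a : ℕ) : Zp l)) * vdm N (fun a => XVal N q s muP a ((h a : ℕ)))) •
      rightSoV l N q s a0 αm βm P Bm muP j (fun n => (h n : ℕ))

/-- the renormalized operator `B̂_-(λ)` -/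
def bHatOp (l N : ℕ) (q s : ℂ) (P : BulkParams N) (Bm : Bdry) (lam : ℂ) : Op l N :=
  ((Bm.ζ - Bm.ζ⁻¹) /
      (Bm.κ * Complex.exp Bm.τ * (lam ^ 2 / q - q / lam ^ 2) * ∏ n, (P.α n * P.β n))) •
    opB l N q s P Bm lam

/-- the state `|ω̄⟩` -/
def omegaBar (l N : ℕ) (q s a0 αm βm : ℂ) (P : BulkParams N) (Bm : Bdry) (muP : Fin N → ℂ)
    (j : Fin N → ℕ) : HIdx l N → ℂ :=
  ∑ h : Fin N → Fin (2 * l + 1),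
    (vdm N (fun a => XVal N q s muP a ((h a : ℕ)))) •
      rightSoV l N q s a0 αm βm P Bm muP j (fun n => (h n : ℕ))

/-- the recursively defined coefficients `t^{(h)}`:
`t^{(0)} = 1`, `t^{(1)} = F 0`, `t^{(h+2)} = F(h+1) t^{(h+1)} - G(h+1) t^{(h)}` -/
def tseq (F G : ℕ → ℂ) : ℕ → ℂ
  | 0 => 1
  | 1 => F 0
  | (h + 2) => F (h + 1) * tseq F G (h + 1) - G (h + 1) * tseq F G h

end SixV

namespace SixV

/-- the boundary quantum determinant `det_q U_-(λ)` -/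
def detqU (l N : ℕ) (q s : ℂ) (P : BulkParams N) (Bm : Bdry) (lam : ℂ) : Op l N :=
  ((lam / q) ^ 2 - (q / lam) ^ 2) •
    (opA l N q s P Bm (lam * s) * opA l N q s P Bm (s / lam) +
     opB l N q s P Bm (lam * s) * opC l N q s P Bm (s / lam))


/-- the auxiliary-space adjugate -/
def adj2 {R : Type*} [Ring R] (X : Matrix (Fin 2) (Fin 2) R) : Matrix (Fin 2) (Fin 2) R :=
  Matrix.of ![![X 1 1, -X 0 1], ![-X 1 0, X 0 0]]

lemma adj2_mul {R : Type*} [Ring R] (X Y : Matrix (Fin 2) (Fin 2) R)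
    (h : ∀ i j k m, Commute (X i j) (Y k m)) : adj2 (X * Y) = adj2 Y * adj2 X := by
  ext i j
  fin_cases i <;> fin_cases j <;>
    simp [adj2, Matrix.mul_apply, Fin.sum_univ_two, (h _ _ _ _).eq] <;> abel

lemma adj2_one {R : Type*} [Ring R] : adj2 (1 : Matrix (Fin 2) (Fin 2) R) = 1 := by
  ext i j
  fin_cases i <;> fin_cases j <;> simp [adj2]

lemma prod_comm_aux {R ι : Type*} [Ring R] (g : ι → Matrix (Fin 2) (Fin 2) R) (n : ι)
    (L : List ι) (hn : n ∉ L)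
    (hg : ∀ n m, n ≠ m → ∀ i j k r, Commute (g n i j) (g m k r)) :
    ∀ i j k r, Commute (g n i j) ((L.map g).prod k r) := by
  induction L with
  | nil =>
    intro i j k r
    by_cases h : k = r
    · subst h; simp
    · simp [Matrix.one_apply, h]
  | cons m L ih =>
    intro i j k r
    simp only [List.mem_cons, not_or] at hn
    simp only [List.map_cons, List.prod_cons, Matrix.mul_apply]
    apply Commute.sum_right
    intro t _
    exact (hg n m hn.1 _ _ _ _).mul_right (ih hn.2 _ _ _ _)

lemma prod_adj {R ι : Type*} [Ring R] [Algebra ℂ R] (f g : ι → Matrix (Fin 2) (Fin 2) R)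
    (c : ι → ℂ)
    (hg : ∀ n m, n ≠ m → ∀ i j k r, Commute (g n i j) (g m k r))
    (h1 : ∀ n, f n * adj2 (g n) = c n • (1 : Matrix (Fin 2) (Fin 2) R))
    (h2 : ∀ n, adj2 (g n) * f n = c n • (1 : Matrix (Fin 2) (Fin 2) R))
    (L : List ι) (hL : L.Nodup) :
    (L.map f).prod * adj2 (L.map g).prod = (L.map c).prod • (1 : Matrix (Fin 2) (Fin 2) R) ∧
    adj2 (L.map g).prod * (L.map f).prod = (L.map c).prod • (1 : Matrix (Fin 2) (Fin 2) R) := by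
  induction L with
  | nil => simp [adj2_one]
  | cons n L ih =>
    rw [List.nodup_cons] at hL
    obtain ⟨i1, i2⟩ := ih hL.2
    simp only [List.map_cons, List.prod_cons]
    rw [adj2_mul _ _ (prod_comm_aux g n L hL.1 hg)]
    constructor
    · calc _ = f n * ((L.map f).prod * adj2 (L.map g).prod) * adj2 (g n) := by
            simp only [mul_assoc]
        _ = _ := by
            rw [i1, mul_smul_comm, mul_one, smul_mul_assoc, h1, smul_smul, mul_comm]
    · calc _ = adj2 (L.map g).prod * (adj2 (g n) * f n) * (L.map f).prod := by
            simp only [mul_assoc]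
        _ = _ := by
            rw [h2, mul_smul_comm, mul_one, smul_mul_assoc, i2, smul_smul]

/-! ### site embedding -/

lemma site_apply (l N : ℕ) (n : Fin N) (A : Matrix (Zp l) (Zp l) ℂ) (x y : HIdx l N) :
    site l N n A x y = if (∀ m, m ≠ n → x m = y m) then A (x n) (y n) else 0 := by
  unfold site
  simp only [Matrix.of_apply]
  rw [Finset.prod_ite_zero]
  simp

lemma site_mul_apply (l N : ℕ) (n : Fin N) (A : Matrix (Zp l) (Zp l) ℂ) (M : Op l N)
    (x y : HIdx l N) :
    (site l N n A * M) x y = ∑ k, A (x n) k * M (Function.update x n k) y := by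
  rw [Matrix.mul_apply]
  symm
  apply Finset.sum_of_injOn (fun k => Function.update x n k)
  · intro a _ b _ hab
    have := congrFun hab n
    simpa using this
  · intro a _; simp
  · intro z _ hz
    rw [site_apply, if_neg, zero_mul]
    intro h
    apply hz
    refine ⟨z n, by simp, ?_⟩
    funext m
    by_cases hm : m = n
    · subst hm; simp
    · simp [hm, h m hm]
  · intro k _
    rw [site_apply, if_pos]
    · simp
    · intro m hm; simp [hm]

lemma site_mul (l N : ℕ) (n : Fin N) (A B : Matrix (Zp l) (Zp l) ℂ) :
    site l N n A * site l N n B = site l N n (A * B) := by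
  ext x y
  rw [site_mul_apply, site_apply, Matrix.mul_apply]
  split_ifs with h
  · apply Finset.sum_congr rfl
    intro k _
    rw [site_apply, if_pos]
    · simp
    · intro m hm; simp [hm, h m hm]
  · apply Finset.sum_eq_zero
    intro k _
    rw [site_apply, if_neg, mul_zero]
    intro h'
    apply h
    intro m hm
    simpa [hm] using h' m hm

lemma site_mul_ne (l N : ℕ) (n r : Fin N) (hnr : n ≠ r) (A B : Matrix (Zp l) (Zp l) ℂ)
    (x y : HIdx l N) :
    (site l N n A * site l N r B) x y =
      if (∀ m, m ≠ n → m ≠ r → x m = y m) then A (x n) (y n) * B (x r) (y r) else 0 := by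
  rw [site_mul_apply, Finset.sum_eq_single (y n)]
  · rw [site_apply]
    have : (∀ m, m ≠ r → Function.update x n (y n) m = y m) ↔
        (∀ m, m ≠ n → m ≠ r → x m = y m) := by
      constructor
      · intro h m h1 h2
        simpa [h1] using h m h2
      · intro h m h2
        by_cases h1 : m = n
        · subst h1; simp
        · simpa [h1] using h m h1 h2
    simp only [this]
    simp [hnr.symm]
  · intro k _ hk
    rw [site_apply, if_neg, mul_zero]
    intro h
    apply hk
    simpa using h n hnr
  · simp

lemma site_comm (l N : ℕ) (n r : Fin N) (hnr : n ≠ r) (A B : Matrix (Zp l) (Zp l) ℂ) :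
    Commute (site l N n A) (site l N r B) := by
  unfold Commute SemiconjBy
  ext x y
  rw [site_mul_ne l N n r hnr, site_mul_ne l N r n hnr.symm]
  have : (∀ m, m ≠ n → m ≠ r → x m = y m) ↔ (∀ m, m ≠ r → m ≠ n → x m = y m) :=
    ⟨fun h m a b => h m b a, fun h m a b => h m b a⟩
  simp only [this, mul_comm]

lemma site_add (l N : ℕ) (n : Fin N) (A B : Matrix (Zp l) (Zp l) ℂ) :
    site l N n (A + B) = site l N n A + site l N n B := by
  ext x y
  simp only [site_apply, Matrix.add_apply]
  split_ifs <;> simp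

lemma site_neg (l N : ℕ) (n : Fin N) (A : Matrix (Zp l) (Zp l) ℂ) :
    site l N n (-A) = -site l N n A := by
  ext x y
  simp only [site_apply, Matrix.neg_apply]
  split_ifs <;> simp

lemma site_smul_one (l N : ℕ) (n : Fin N) (c : ℂ) :
    site l N n (c • 1) = c • (1 : Op l N) := by
  ext x y
  simp only [site_apply, Matrix.smul_apply, Matrix.one_apply]
  by_cases h : x = y
  · subst h; simp
  · rw [if_neg h]
    by_cases h2 : ∀ m, m ≠ n → x m = y m
    · rw [if_pos h2, if_neg]
      intro h3
      apply h
      funext m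
      by_cases hm : m = n
      · subst hm; exact h3
      · exact h2 m hm
    · rw [if_neg h2]; simp

lemma site_zero (l N : ℕ) (n : Fin N) : site l N n 0 = 0 := by
  ext x y
  simp [site_apply]

/-- entrywise embedding -/
def siteM (l N : ℕ) (n : Fin N) (X : Matrix (Fin 2) (Fin 2) (Matrix (Zp l) (Zp l) ℂ)) :
    Matrix (Fin 2) (Fin 2) (Op l N) := Matrix.of fun i j => site l N n (X i j)

lemma siteM_mul (l N : ℕ) (n : Fin N) (X Y : Matrix (Fin 2) (Fin 2) (Matrix (Zp l) (Zp l) ℂ)) :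
    siteM l N n X * siteM l N n Y = siteM l N n (X * Y) := by
  ext1 i j
  simp [siteM, Matrix.mul_apply, Fin.sum_univ_two, site_mul, site_add]

lemma siteM_adj (l N : ℕ) (n : Fin N) (X : Matrix (Fin 2) (Fin 2) (Matrix (Zp l) (Zp l) ℂ)) :
    adj2 (siteM l N n X) = siteM l N n (adj2 X) := by
  ext1 i j
  fin_cases i <;> fin_cases j <;> simp [siteM, adj2, site_neg]

lemma siteM_smul_one (l N : ℕ) (n : Fin N) (c : ℂ) :
    siteM l N n (c • 1) = c • (1 : Matrix (Fin 2) (Fin 2) (Op l N)) := by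
  ext1 i j
  fin_cases i <;> fin_cases j <;> simp [siteM, site_smul_one, site_zero]

/-! ### local algebra -/

/-- `x v + y v⁻¹` -/
def dg (l : ℕ) (q x y : ℂ) : Matrix (Zp l) (Zp l) ℂ := x • vM l q + y • vMinv l q

lemma pow_val_add (l : ℕ) (q : ℂ) (hq : q ^ (2 * l + 1) = 1) (k : Zp l) :
    q ^ (k + 1).val = q ^ k.val * q := by
  rw [ZMod.val_add, ← pow_eq_pow_mod _ hq, pow_add, ZMod.val_one_eq_one_mod,
    ← pow_eq_pow_mod _ hq, pow_one]

lemma dg_diag (l : ℕ) (q x y : ℂ) :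
    dg l q x y = Matrix.diagonal fun k => x * q ^ k.val + y * (q ^ k.val)⁻¹ := by
  ext i j
  by_cases h : i = j
  · subst h; simp [dg, vM, vMinv]
  · simp [dg, vM, vMinv, h]

lemma dg_u (l : ℕ) (q x y : ℂ) (hq : q ^ (2 * l + 1) = 1) :
    dg l q x y * uM l = uM l * dg l q (x / q) (y * q) := by
  have hq0 : q ≠ 0 := by rintro rfl; simp at hq
  rw [dg_diag, dg_diag]
  ext i j
  rw [Matrix.diagonal_mul, Matrix.mul_diagonal]
  simp only [uM, Matrix.of_apply]
  split_ifs with h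
  · have : j = i + 1 := by rw [h]; ring
    rw [this, pow_val_add l q hq]
    field_simp
  · simp

lemma dg_ui (l : ℕ) (q x y : ℂ) (hq : q ^ (2 * l + 1) = 1) :
    dg l q x y * uMinv l = uMinv l * dg l q (x * q) (y / q) := by
  have hq0 : q ≠ 0 := by rintro rfl; simp at hq
  rw [dg_diag, dg_diag]
  ext i j
  rw [Matrix.diagonal_mul, Matrix.mul_diagonal]
  simp only [uMinv, Matrix.of_apply]
  split_ifs with h
  · rw [h, pow_val_add l q hq]
    field_simp
  · simp

lemma u_ui (l : ℕ) : uM l * uMinv l = 1 := by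
  ext i j
  rw [Matrix.mul_apply, Finset.sum_eq_single (j + 1)]
  · simp [uM, uMinv, Matrix.one_apply]
  · intro b _ hb; simp [uMinv, hb]
  · simp

lemma ui_u (l : ℕ) : uMinv l * uM l = 1 := by
  ext i j
  rw [Matrix.mul_apply, Finset.sum_eq_single (j - 1)]
  · simp [uM, uMinv, Matrix.one_apply]
  · intro b _ hb; simp [uM, hb]
  · simp

lemma u_dg_ui_dg (l : ℕ) (q x y x' y' : ℂ) (hq : q ^ (2 * l + 1) = 1) :
    uM l * dg l q x y * (uMinv l * dg l q x' y') = dg l q (x * q) (y / q) * dg l q x' y' := by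
  calc _ = uM l * (dg l q x y * uMinv l) * dg l q x' y' := by simp only [mul_assoc]
    _ = uM l * uMinv l * dg l q (x * q) (y / q) * dg l q x' y' := by
        rw [dg_ui l q x y hq]; simp only [mul_assoc]
    _ = _ := by rw [u_ui, one_mul]

lemma ui_dg_u_dg (l : ℕ) (q x y x' y' : ℂ) (hq : q ^ (2 * l + 1) = 1) :
    uMinv l * dg l q x y * (uM l * dg l q x' y') = dg l q (x / q) (y * q) * dg l q x' y' := by
  calc _ = uMinv l * (dg l q x y * uM l) * dg l q x' y' := by simp only [mul_assoc]
    _ = uMinv l * uM l * dg l q (x / q) (y * q) * dg l q x' y' := by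
        rw [dg_u l q x y hq]; simp only [mul_assoc]
    _ = _ := by rw [ui_u, one_mul]

lemma dg_u_dg (l : ℕ) (q x y x' y' : ℂ) (hq : q ^ (2 * l + 1) = 1) :
    dg l q x y * (uM l * dg l q x' y') = uM l * (dg l q (x / q) (y * q) * dg l q x' y') := by
  rw [← mul_assoc, dg_u l q x y hq, mul_assoc]

lemma dg_ui_dg (l : ℕ) (q x y x' y' : ℂ) (hq : q ^ (2 * l + 1) = 1) :
    dg l q x y * (uMinv l * dg l q x' y') = uMinv l * (dg l q (x * q) (y / q) * dg l q x' y') := by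
  rw [← mul_assoc, dg_ui l q x y hq, mul_assoc]

lemma dg_mul_sub (l : ℕ) (q x y x' y' z w z' w' c : ℂ) (hq0 : q ≠ 0)
    (h1 : x * x' = z * z') (h2 : y * y' = w * w')
    (h3 : x * y' + y * x' - (z * w' + w * z') = c) :
    dg l q x y * dg l q x' y' - dg l q z w * dg l q z' w' = c • 1 := by
  simp only [dg_diag, Matrix.diagonal_mul_diagonal, Matrix.diagonal_sub]
  rw [← Matrix.diagonal_one, ← Matrix.diagonal_smul]
  congr 1
  funext k
  have hk : q ^ k.val ≠ 0 := pow_ne_zero _ hq0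
  simp only [Pi.smul_apply, smul_eq_mul, mul_one]
  generalize q ^ k.val = t at hk
  subst h3
  have : t * t⁻¹ = 1 := mul_inv_cancel₀ hk
  linear_combination t ^ 2 * h1 + t⁻¹ ^ 2 * h2 +
    (x * y' + y * x' - (z * w' + w * z')) * this

/-- the local quantum determinant -/
def cL (q pα pβ pa pb pc pd x : ℂ) : ℂ :=
  -((pβ / x + q⁻¹ * pb * pα * x / pa) *
    (pa * pc / pα * ((x / q)⁻¹ + q * pd * pα * (x / q) / (pc * pβ))))

lemma laxM_eq (l : ℕ) (q s pα pβ pa pb pc pd x : ℂ) :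
    laxM l q s pα pβ pa pb pc pd x = Matrix.of
    ![![dg l q (x * pα) (-(pβ / x)), uM l * dg l q (pa / s) (s * pb)],
      ![uMinv l * dg l q (s * pc) (pd / s),
        dg l q (pa * pc / pα / x) (-(pb * pd / pβ * x))]] := by
  simp [laxM, dg, sub_eq_add_neg]

lemma dg_comm (l : ℕ) (q x y x' y' : ℂ) :
    dg l q x y * dg l q x' y' = dg l q x' y' * dg l q x y := by
  simp only [dg_diag, Matrix.diagonal_mul_diagonal, mul_comm]

lemma lax_adj (l : ℕ) (q s pα pβ pa pb pc pd x : ℂ) (hq : q ^ (2 * l + 1) = 1)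
    (hs : s ^ 2 = q) (hα : pα ≠ 0) (hβ : pβ ≠ 0) (ha : pa ≠ 0) (hc : pc ≠ 0) (hx : x ≠ 0) :
    laxM l q s pα pβ pa pb pc pd x * adj2 (laxM l q s pα pβ pa pb pc pd (x / q)) =
      cL q pα pβ pa pb pc pd x • 1 := by
  have hq0 : q ≠ 0 := by rintro rfl; simp at hq
  have hs0 : s ≠ 0 := by rintro rfl; simp at hs; exact hq0 hs.symm
  rw [laxM_eq, laxM_eq]
  ext1 i j
  fin_cases i <;> fin_cases j <;>
    simp only [adj2, Matrix.mul_apply, Fin.sum_univ_two, Matrix.of_apply, Matrix.smul_apply,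
      Matrix.one_apply, Matrix.cons_val_zero, Matrix.cons_val_one, Fin.zero_eta, Fin.mk_one,
      Fin.isValue, if_true, mul_neg, zero_ne_one, one_ne_zero, if_false, smul_zero,
      Matrix.cons_val_fin_one]
  · rw [← sub_eq_add_neg, u_dg_ui_dg l q _ _ _ _ hq]
    apply dg_mul_sub _ _ _ _ _ _ _ _ _ _ _ hq0
    · field_simp
    · field_simp
    · unfold cL; subst hs; field_simp; ring
  · rw [dg_u_dg l q _ _ _ _ hq, mul_assoc, dg_comm l q (pa / s)]
    rw [show x * pα / q = x / q * pα by ring, show -(pβ / x) * q = -(pβ / (x / q)) by field_simp]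
    abel
  · rw [dg_ui_dg l q _ _ _ _ hq, mul_assoc, dg_comm l q (s * pc)]
    rw [show pa * pc / pα / x * q = pa * pc / pα / (x / q) by field_simp,
      show -(pb * pd / pβ * x) / q = -(pb * pd / pβ * (x / q)) by ring]
    abel
  · rw [neg_add_eq_sub, ui_dg_u_dg l q _ _ _ _ hq]
    apply dg_mul_sub _ _ _ _ _ _ _ _ _ _ _ hq0
    · field_simp
    · field_simp
    · unfold cL; subst hs; field_simp; ring

lemma adj_lax (l : ℕ) (q s pα pβ pa pb pc pd x : ℂ) (hq : q ^ (2 * l + 1) = 1)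
    (hs : s ^ 2 = q) (hα : pα ≠ 0) (hβ : pβ ≠ 0) (ha : pa ≠ 0) (hc : pc ≠ 0) (hx : x ≠ 0) :
    adj2 (laxM l q s pα pβ pa pb pc pd (x / q)) * laxM l q s pα pβ pa pb pc pd x =
      cL q pα pβ pa pb pc pd x • 1 := by
  have hq0 : q ≠ 0 := by rintro rfl; simp at hq
  have hs0 : s ≠ 0 := by rintro rfl; simp at hs; exact hq0 hs.symm
  rw [laxM_eq, laxM_eq]
  ext1 i j
  fin_cases i <;> fin_cases j <;>
    simp only [adj2, Matrix.mul_apply, Fin.sum_univ_two, Matrix.of_apply, Matrix.smul_apply,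
      Matrix.one_apply, Matrix.cons_val_zero, Matrix.cons_val_one, Fin.zero_eta, Fin.mk_one,
      Fin.isValue, if_true, neg_mul, zero_ne_one, one_ne_zero, if_false, smul_zero,
      Matrix.cons_val_fin_one]
  · rw [← sub_eq_add_neg, u_dg_ui_dg l q _ _ _ _ hq]
    apply dg_mul_sub _ _ _ _ _ _ _ _ _ _ _ hq0
    · field_simp
    · field_simp
    · unfold cL; subst hs; field_simp; ring
  · rw [dg_u_dg l q _ _ _ _ hq, mul_assoc, dg_comm l q (pa / s)]
    rw [show pa * pc / pα / (x / q) / q = pa * pc / pα / x by field_simp,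
      show -(pb * pd / pβ * (x / q)) * q = -(pb * pd / pβ * x) by field_simp]
    abel
  · rw [dg_ui_dg l q _ _ _ _ hq, mul_assoc, dg_comm l q (s * pc)]
    rw [show x / q * pα * q = x * pα by field_simp,
      show -(pβ / (x / q)) / q = -(pβ / x) by field_simp]
    abel
  · rw [neg_add_eq_sub, ui_dg_u_dg l q _ _ _ _ hq]
    apply dg_mul_sub _ _ _ _ _ _ _ _ _ _ _ hq0
    · field_simp
    · field_simp
    · unfold cL; subst hs; field_simp; ring

/-! ### monodromy -/

lemma mono_adj (l N : ℕ) (q s : ℂ) (hq : q ^ (2 * l + 1) = 1) (hs : s ^ 2 = q)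
    (P : BulkParams N) (hP : P.NonZero) (x : ℂ) (hx : x ≠ 0) :
    mono l N q s P (x * s) * adj2 (mono l N q s P (x / s)) =
      (∏ n, cL q (P.α n) (P.β n) (P.a n) (P.b n) (P.c n) (P.d n) x) • 1 ∧
    adj2 (mono l N q s P (x / s)) * mono l N q s P (x * s) =
      (∏ n, cL q (P.α n) (P.β n) (P.a n) (P.b n) (P.c n) (P.d n) x) • 1 := by
  have hq0 : q ≠ 0 := by rintro rfl; simp at hq
  have hs0 : s ≠ 0 := by rintro rfl; simp at hs; exact hq0 hs.symm
  have e1 : x * s / s = x := by field_simp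
  have e2 : x / s / s = x / q := by rw [← hs]; field_simp
  have key := prod_adj (fun n => laxSite l N q s P n x) (fun n => laxSite l N q s P n (x / q))
    (fun n => cL q (P.α n) (P.β n) (P.a n) (P.b n) (P.c n) (P.d n) x)
    (fun n m hnm i j k r => site_comm l N n m hnm _ _)
    (fun n => by
      obtain ⟨h1, h2, h3, h4, h5, h6⟩ := hP n
      change siteM l N n _ * adj2 (siteM l N n _) = _
      rw [siteM_adj, siteM_mul, lax_adj l q s _ _ _ _ _ _ x hq hs h1 h2 h3 h5 hx, siteM_smul_one])
    (fun n => by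
      obtain ⟨h1, h2, h3, h4, h5, h6⟩ := hP n
      change adj2 (siteM l N n _) * siteM l N n _ = _
      rw [siteM_adj, siteM_mul, adj_lax l q s _ _ _ _ _ _ x hq hs h1 h2 h3 h5 hx, siteM_smul_one])
    (List.finRange N).reverse (List.nodup_reverse.mpr (List.nodup_finRange N))
  rw [List.map_reverse (f := fun n => cL q (P.α n) (P.β n) (P.a n) (P.b n) (P.c n) (P.d n) x),
    List.prod_reverse, ← List.ofFn_eq_map, List.prod_ofFn] at key
  unfold mono
  rw [e1, e2]
  exact key

lemma mHat_eq (l N : ℕ) (q s : ℂ) (P : BulkParams N) (lam : ℂ) :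
    mHat l N q s P lam = ((-1 : ℂ) ^ N) • adj2 (mono l N q s P lam⁻¹) := by
  unfold mHat
  congr 1
  ext1 i j
  fin_cases i <;> fin_cases j <;>
    simp [adj2, sigY, Matrix.mul_apply, Matrix.vecMul, dotProduct, Fin.sum_univ_two, smul_smul]

/-- scalar in `K K` -/
def cK (B : Bdry) (x : ℂ) : ℂ :=
  (B.ζ - B.ζ⁻¹)⁻¹ ^ 2 * ((x * B.ζ - (x * B.ζ)⁻¹) * (B.ζ / x - x / B.ζ) -
    B.κ ^ 2 * (x ^ 2 - (x ^ 2)⁻¹) ^ 2)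

lemma kM_mul (q s : ℂ) (hs : s ^ 2 = q) (hs0 : s ≠ 0) (B : Bdry) (x : ℂ) (hx : x ≠ 0) :
    kM q s B (x * s) * kM q s B (s / x) = cK B x • 1 := by
  subst hs
  have he : Complex.exp B.τ * Complex.exp (-B.τ) = 1 := by
    rw [← Complex.exp_add]; simp
  have t1 : (x * s) ^ 2 / s ^ 2 - s ^ 2 / (x * s) ^ 2 = x ^ 2 - (x ^ 2)⁻¹ := by field_simp
  have t2 : (s / x) ^ 2 / s ^ 2 - s ^ 2 / (s / x) ^ 2 = -(x ^ 2 - (x ^ 2)⁻¹) := by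
    field_simp; ring
  have t3 : x * s * B.ζ / s - s / (x * s * B.ζ) = x * B.ζ - (x * B.ζ)⁻¹ := by
    congr 1
    · field_simp
    · rw [show x * s * B.ζ = s * (x * B.ζ) by ring, div_mul_eq_div_div, div_self hs0, one_div]
  have t4 : s * B.ζ / (x * s) - x * s / (B.ζ * s) = B.ζ / x - x / B.ζ := by
    rw [mul_comm x s, mul_div_mul_left _ _ hs0, mul_comm B.ζ s, mul_div_mul_left _ _ hs0]
  have t5 : s / x * B.ζ / s - s / (s / x * B.ζ) = B.ζ / x - x / B.ζ := by
    congr 1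
    · field_simp
    · rw [div_mul_eq_mul_div, div_div_eq_mul_div, mul_div_mul_left _ _ hs0]
  have t6 : s * B.ζ / (s / x) - s / x / (B.ζ * s) = x * B.ζ - (x * B.ζ)⁻¹ := by
    congr 1
    · field_simp
    · rw [div_div, show x * (B.ζ * s) = s * (x * B.ζ) by ring, div_mul_eq_div_div, div_self hs0,
        one_div]
  unfold kM cK
  rw [t1, t2, t3, t4, t5, t6]
  clear t1 t2 t3 t4 t5 t6
  generalize x * B.ζ - (x * B.ζ)⁻¹ = p
  generalize B.ζ / x - x / B.ζ = r
  generalize x ^ 2 - (x ^ 2)⁻¹ = w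
  generalize (B.ζ - B.ζ⁻¹)⁻¹ = z
  generalize Complex.exp B.τ = E at *
  generalize Complex.exp (-B.τ) = E' at *
  ext i j
  fin_cases i <;> fin_cases j <;>
    simp [Matrix.mul_apply, Fin.sum_univ_two]
  · linear_combination (-(z ^ 2 * B.κ ^ 2 * w ^ 2)) * he
  · ring
  · ring
  · linear_combination (-(z ^ 2 * B.κ ^ 2 * w ^ 2)) * he

lemma lift2_mul (l N : ℕ) (K K' : Matrix (Fin 2) (Fin 2) ℂ) :
    lift2 l N K * lift2 l N K' = lift2 l N (K * K') := by
  ext1 i j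
  simp [lift2, Matrix.mul_apply, Fin.sum_univ_two, smul_smul, add_smul, mul_comm]

lemma lift2_smul_one (l N : ℕ) (c : ℂ) :
    lift2 l N (c • 1) = c • 1 := by
  ext1 i j
  fin_cases i <;> fin_cases j <;> simp [lift2]

lemma uu (l N : ℕ) (q s : ℂ) (hq : q ^ (2 * l + 1) = 1) (hs : s ^ 2 = q)
    (P : BulkParams N) (hP : P.NonZero) (B : Bdry) (x : ℂ) (hx : x ≠ 0) :
    uBdry l N q s P B (x * s) * uBdry l N q s P B (s / x) =
      (cK B x * ((∏ n, cL q (P.α n) (P.β n) (P.a n) (P.b n) (P.c n) (P.d n) x) *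
        ∏ n, cL q (P.α n) (P.β n) (P.a n) (P.b n) (P.c n) (P.d n) x⁻¹)) • 1 := by
  have hq0 : q ≠ 0 := by rintro rfl; simp at hq
  have hs0 : s ≠ 0 := by rintro rfl; simp at hs; exact hq0 hs.symm
  have m1 := (mono_adj l N q s hq hs P hP x hx).1
  have m2 := (mono_adj l N q s hq hs P hP x⁻¹ (inv_ne_zero hx)).2
  have hk := kM_mul q s hs hs0 B x hx
  unfold uBdry
  rw [mHat_eq, mHat_eq]
  rw [show (s / x)⁻¹ = x / s by simp, show (x * s)⁻¹ = x⁻¹ / s by field_simp]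
  rw [show s / x = x⁻¹ * s by field_simp] at *
  set c1 := ∏ n, cL q (P.α n) (P.β n) (P.a n) (P.b n) (P.c n) (P.d n) x
  set c2 := ∏ n, cL q (P.α n) (P.β n) (P.a n) (P.b n) (P.c n) (P.d n) x⁻¹
  have hk' : lift2 l N (kM q s B (x * s)) * lift2 l N (kM q s B (x⁻¹ * s)) = cK B x • 1 := by
    rw [lift2_mul, hk, lift2_smul_one]
  have hsg : ((-1 : ℂ) ^ N) * (-1) ^ N = 1 := by
    rw [← mul_pow]; simp
  calc _ = (((-1 : ℂ) ^ N) * (-1) ^ N) • (mono l N q s P (x * s) *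
        (lift2 l N (kM q s B (x * s)) *
          (adj2 (mono l N q s P (x⁻¹ / s)) * mono l N q s P (x⁻¹ * s)) *
          lift2 l N (kM q s B (x⁻¹ * s))) * adj2 (mono l N q s P (x / s))) := by
        simp only [mul_smul_comm, smul_mul_assoc, smul_smul, mul_assoc]
    _ = _ := by
        rw [hsg, one_smul, m2, mul_smul_comm, mul_one, smul_mul_assoc, hk', smul_smul,
          mul_smul_comm, mul_one, smul_mul_assoc, m1, smul_smul]
        congr 1; ring

lemma scal (N : ℕ) (q s : ℂ) (hq0 : q ≠ 0) (hs : s ^ 2 = q)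
    (P : BulkParams N) (Bm : Bdry) (hζm : Bm.ζ ^ 2 ≠ 1) (hκm : Bm.κ ≠ 0)
    (a0 αm βm : ℂ) (ha0 : a0 ≠ 0) (hαm : αm ≠ 0) (hβm : βm ≠ 0)
    (hre1 : (αm - αm⁻¹) * (βm + βm⁻¹) = (Bm.ζ - Bm.ζ⁻¹) / Bm.κ)
    (hre2 : (αm + αm⁻¹) * (βm - βm⁻¹) = (Bm.ζ + Bm.ζ⁻¹) / Bm.κ) (x : ℂ) (hx : x ≠ 0) :
    cK Bm x * ((∏ n, cL q (P.α n) (P.β n) (P.a n) (P.b n) (P.c n) (P.d n) x) *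
        ∏ n, cL q (P.α n) (P.β n) (P.a n) (P.b n) (P.c n) (P.d n) x⁻¹) =
      AAm N q s a0 αm βm P (x * s) * AAm N q s a0 αm βm P (s / x) := by
  have hs0 : s ≠ 0 := by rintro rfl; simp at hs; exact hq0 hs.symm
  have hc : ∀ y : ℂ, (∏ n, cL q (P.α n) (P.β n) (P.a n) (P.b n) (P.c n) (P.d n) y) =
      aBulk N q a0 P y * dBulk N q a0 P (y / q) := by
    intro y
    unfold cL aBulk dBulk
    rw [Finset.prod_neg, Finset.prod_mul_distrib]
    simp only [Finset.card_univ, Fintype.card_fin]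
    generalize (∏ n, (P.β n / y + q⁻¹ * P.b n * P.α n * y / P.a n)) = p1
    generalize (∏ n, (P.a n * P.c n / P.α n *
      ((y / q)⁻¹ + q * P.d n * P.α n * (y / q) / (P.c n * P.β n)))) = p2
    field_simp
  have hg : cK Bm x = gMin s αm βm (x * s) * gMin s αm βm (s / x) := by
    by_cases hz : Bm.ζ = 0
    · have h0 : (αm - αm⁻¹) * (βm + βm⁻¹) = 0 := by rw [hre1, hz]; simp
      unfold cK gMin
      rw [h0, hz]
      simp
    · have hD : Bm.ζ - Bm.ζ⁻¹ ≠ 0 := by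
        intro h
        apply hζm
        field_simp at h
        linear_combination h
      have g1 := congrArg (fun t => t ^ 2 * Bm.κ ^ 2) hre1
      have g2 := congrArg (fun t => t ^ 2 * Bm.κ ^ 2) hre2
      simp only [div_pow, div_mul_cancel₀ _ (pow_ne_zero 2 hκm)] at g1 g2
      have na : (x * s * αm / s - s / (x * s * αm)) * (s / x * αm / s - s / (s / x * αm)) =
          αm ^ 2 + αm⁻¹ ^ 2 - (x ^ 2 + x⁻¹ ^ 2) := by field_simp; ring
      have nb : (x * s * βm / s + s / (x * s * βm)) * (s / x * βm / s + s / (s / x * βm)) =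
          βm ^ 2 + βm⁻¹ ^ 2 + (x ^ 2 + x⁻¹ ^ 2) := by field_simp; ring
      have nz : (x * Bm.ζ - (x * Bm.ζ)⁻¹) * (Bm.ζ / x - x / Bm.ζ) =
          Bm.ζ ^ 2 + Bm.ζ⁻¹ ^ 2 - (x ^ 2 + x⁻¹ ^ 2) := by field_simp; ring
      have nx : (x ^ 2 - (x ^ 2)⁻¹) ^ 2 = (x ^ 2 + x⁻¹ ^ 2) ^ 2 - 4 := by field_simp; ring
      have na' : (αm - αm⁻¹) ^ 2 = αm ^ 2 + αm⁻¹ ^ 2 - 2 := by field_simp; ring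
      have na2 : (αm + αm⁻¹) ^ 2 = αm ^ 2 + αm⁻¹ ^ 2 + 2 := by field_simp; ring
      have nb' : (βm - βm⁻¹) ^ 2 = βm ^ 2 + βm⁻¹ ^ 2 - 2 := by field_simp; ring
      have nb2 : (βm + βm⁻¹) ^ 2 = βm ^ 2 + βm⁻¹ ^ 2 + 2 := by field_simp; ring
      have nz' : (Bm.ζ - Bm.ζ⁻¹) ^ 2 = Bm.ζ ^ 2 + Bm.ζ⁻¹ ^ 2 - 2 := by field_simp; ring
      have nz2 : (Bm.ζ + Bm.ζ⁻¹) ^ 2 = Bm.ζ ^ 2 + Bm.ζ⁻¹ ^ 2 + 2 := by field_simp; ring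
      rw [mul_pow, na', nb2, nz'] at g1
      rw [mul_pow, na2, nb', nz2] at g2
      unfold cK gMin
      rw [hre1, nz, nx, div_mul_div_comm, mul_mul_mul_comm, na, nb]
      clear na nb nz nx na' na2 nb' nb2 nz' nz2
      generalize αm ^ 2 + αm⁻¹ ^ 2 = a at *
      generalize βm ^ 2 + βm⁻¹ ^ 2 = b at *
      generalize x ^ 2 + x⁻¹ ^ 2 = X at *
      generalize Bm.ζ ^ 2 + Bm.ζ⁻¹ ^ 2 = z at *
      generalize Bm.ζ - Bm.ζ⁻¹ = D at *
      field_simp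
      linear_combination (-(1/2) - X / 4) * g1 + (-(1/2) + X / 4) * g2
  rw [hc, hc, hg]
  unfold AAm
  rw [show x * s / s = x by field_simp, show s / x / s = x⁻¹ by field_simp,
    show (s * (x * s))⁻¹ = x⁻¹ / q by rw [← hs]; field_simp,
    show (s * (s / x))⁻¹ = x / q by rw [← hs]; field_simp]
  ring

/-- the boundary quantum determinant: alternative expression,
centrality, and explicit scalar value. -/
theorem boundary_quantum_determinant (l N : ℕ) (hl : 1 ≤ l) (hN : 1 ≤ N) (q s : ℂ)
    (hq : IsPrimitiveRoot q (2 * l + 1)) (hs : s ^ 2 = q)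
    (P : BulkParams N) (hP : P.NonZero)
    (Bm : Bdry) (hζm : Bm.ζ ^ 2 ≠ 1) (hκm : Bm.κ ≠ 0)
    (a0 αm βm : ℂ) (ha0 : a0 ≠ 0) (hαm : αm ≠ 0) (hβm : βm ≠ 0)
    (hre1 : (αm - αm⁻¹) * (βm + βm⁻¹) = (Bm.ζ - Bm.ζ⁻¹) / Bm.κ)
    (hre2 : (αm + αm⁻¹) * (βm - βm⁻¹) = (Bm.ζ + Bm.ζ⁻¹) / Bm.κ) :
    (∀ lam : ℂ, lam ≠ 0 →
      detqU l N q s P Bm lam =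
        ((lam / q) ^ 2 - (q / lam) ^ 2) •
          (opD l N q s P Bm (lam * s) * opD l N q s P Bm (s / lam) +
           opC l N q s P Bm (lam * s) * opB l N q s P Bm (s / lam))) ∧
    (∀ lam mu : ℂ, lam ≠ 0 → mu ≠ 0 →
      Commute (detqU l N q s P Bm lam) (opA l N q s P Bm mu) ∧
      Commute (detqU l N q s P Bm lam) (opB l N q s P Bm mu) ∧
      Commute (detqU l N q s P Bm lam) (opC l N q s P Bm mu) ∧
      Commute (detqU l N q s P Bm lam) (opD l N q s P Bm mu)) ∧
    (∀ lam : ℂ, lam ≠ 0 →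
      detqU l N q s P Bm lam =
        ((lam ^ 2 / q ^ 2 - q ^ 2 / lam ^ 2) *
            AAm N q s a0 αm βm P (lam * s) * AAm N q s a0 αm βm P (s / lam)) •
          (1 : Op l N)) := by
  have hq1 := hq.pow_eq_one
  have hq0 : q ≠ 0 := by rintro rfl; simp at hq1
  have H : ∀ lam : ℂ, lam ≠ 0 →
      uBdry l N q s P Bm (lam * s) * uBdry l N q s P Bm (s / lam) =
        (AAm N q s a0 αm βm P (lam * s) * AAm N q s a0 αm βm P (s / lam)) • 1 := by
    intro lam hlam
    rw [uu l N q s hq1 hs P hP Bm lam hlam,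
      scal N q s hq0 hs P Bm hζm hκm a0 αm βm ha0 hαm hβm hre1 hre2 lam hlam]
  have H3 : ∀ lam : ℂ, lam ≠ 0 →
      detqU l N q s P Bm lam =
        ((lam ^ 2 / q ^ 2 - q ^ 2 / lam ^ 2) *
            AAm N q s a0 αm βm P (lam * s) * AAm N q s a0 αm βm P (s / lam)) •
          (1 : Op l N) := by
    intro lam hlam
    have h := congrFun (congrFun (H lam hlam) 0) 0
    rw [Matrix.mul_apply, Fin.sum_univ_two] at h
    unfold detqU opA opB opC
    rw [h, div_pow, div_pow, Matrix.smul_apply, Matrix.one_apply_eq, smul_smul, mul_assoc]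
  refine ⟨?_, ?_, H3⟩
  · intro lam hlam
    have h := congrFun (congrFun (H lam hlam) 1) 1
    rw [Matrix.mul_apply, Fin.sum_univ_two, add_comm] at h
    rw [H3 lam hlam]
    unfold opB opC opD
    rw [h, div_pow, div_pow, Matrix.smul_apply, Matrix.one_apply_eq, smul_smul, mul_assoc]
  · intro lam mu hlam _
    rw [H3 lam hlam]
    refine ⟨?_, ?_, ?_, ?_⟩ <;> exact (Commute.one_left _).smul_left _

end SixV
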